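/- Let Ω ⊆ ℝ³ be a bounded open set with smooth boundary such that Ω and ℍ¹ ∖ closure(Ω) satisfy the uniform exterior ball property, ξ ∈ Ω, H a regular part of the Green's function of Ω at ξ with H(ξ) > 0, G_ξ = Γ_ξ − H, and r = r_Ω(ξ) = 1/√(8π H(ξ)). Let g(η) = 1/(8π ρ(η)²) − 1/(8π r²) be the Green's function of B(0,r) at 0. Let φ : (0,∞) → [0,∞) be continuously differentiable, and define u = φ ∘ g on B(0,r) ∖ {0} and U = φ ∘ G_ξ on Ω ∖ {ξ} (the harmonic transplantation of u into Ω). Then ∫_Ω ((XU)² + (YU)²) dv = ∫_{B(0,r)} ((Xu)² + (Yu)²) dv. -/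

import Mathlib

open MeasureTheory Real Set

noncomputable section

/-- The underlying space of the Heisenberg group ℍ¹: ℝ³ with coordinates (x, y, t). -/
abbrev H1 : Type := ℝ × ℝ × ℝ

/-- The Koranyi norm ρ(x,y,t) = ((x²+y²)² + t²)^{1/4}. -/
def ρH (η : H1) : ℝ := ((η.1 ^ 2 + η.2.1 ^ 2) ^ 2 + η.2.2 ^ 2) ^ ((1 : ℝ) / 4)

/-- The Heisenberg group law: η∘ξ = (x+x₀, y+y₀, t+t₀+2(x₀y − x y₀)). -/
def hmul (η ξ : H1) : H1 :=
  (η.1 + ξ.1, η.2.1 + ξ.2.1, η.2.2 + ξ.2.2 + 2 * (ξ.1 * η.2.1 - η.1 * ξ.2.1))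

/-- The Heisenberg group inverse: ξ⁻¹ = (−x₀,−y₀,−t₀). -/
def hinv (ξ : H1) : H1 := (-ξ.1, -ξ.2.1, -ξ.2.2)

/-- The Koranyi distance d(ξ,η) = ρ(ξ⁻¹∘η). -/
def kd (ξ η : H1) : ℝ := ρH (hmul (hinv ξ) η)

/-- The Koranyi ball B(ξ,r) = {η : d(ξ,η) < r}. -/
def kball (ξ : H1) (r : ℝ) : Set H1 := {η | kd ξ η < r}

/-- Horizontal derivative Xu = ∂u/∂x + 2y·∂u/∂t, as the derivative along (1,0,2y). -/
def Xd (u : H1 → ℝ) (η : H1) : ℝ := fderiv ℝ u η (1, 0, 2 * η.2.1)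

/-- Horizontal derivative Yu = ∂u/∂y − 2x·∂u/∂t, as the derivative along (0,1,−2x). -/
def Yd (u : H1 → ℝ) (η : H1) : ℝ := fderiv ℝ u η (0, 1, -2 * η.1)

/-- The Kohn-Laplacian Δ_ℍ u = X(Xu) + Y(Yu). -/
def kohn (u : H1 → ℝ) (η : H1) : ℝ := Xd (Xd u) η + Yd (Yd u) η

/-- The fundamental solution with pole ξ: Γ_ξ(η) = 1/(8π d(ξ,η)²). -/
def Γξ (ξ η : H1) : ℝ := 1 / (8 * π * kd ξ η ^ 2)

/-- A set A satisfies the uniform exterior ball property if there exists r₀ > 0 such that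
for every ζ ∈ ∂A and every r ∈ (0,r₀] there exists η with B(η,r) ∩ A = ∅ and ζ ∈ ∂B(η,r). -/
def uebp (A : Set H1) : Prop :=
  ∃ r₀ > (0 : ℝ), ∀ ζ ∈ frontier A, ∀ r : ℝ, 0 < r → r ≤ r₀ →
    ∃ η : H1, kball η r ∩ A = ∅ ∧ ζ ∈ frontier (kball η r)

/-- Ω has C¹ boundary: it is the sublevel set of a C¹ defining function with
nonvanishing gradient on the boundary. -/
def c1Bdry (Ω : Set H1) : Prop :=
  ∃ f : H1 → ℝ, ContDiff ℝ 1 f ∧ Ω = {x | f x < 0} ∧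
    frontier Ω = {x | f x = 0} ∧ ∀ x ∈ frontier Ω, fderiv ℝ f x ≠ 0

/-- Ω has smooth boundary: it is the sublevel set of a smooth defining function with
nonvanishing gradient on the boundary. -/
def smoothBdry (Ω : Set H1) : Prop :=
  ∃ f : H1 → ℝ, ContDiff ℝ (⊤ : ℕ∞) f ∧ Ω = {x | f x < 0} ∧
    frontier Ω = {x | f x = 0} ∧ ∀ x ∈ frontier Ω, fderiv ℝ f x ≠ 0

/-- The horizontal perimeter of Ω:
P_ℍ(Ω) = sup { ∫_Ω (Xa + Yb) : a,b of class C¹ with a²+b² ≤ 1 }. -/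
def horizPerim (Ω : Set H1) : ℝ :=
  sSup { p : ℝ | ∃ a b : H1 → ℝ, ContDiff ℝ 1 a ∧ ContDiff ℝ 1 b ∧
    (∀ η, a η ^ 2 + b η ^ 2 ≤ 1) ∧ p = ∫ η in Ω, (Xd a η + Yd b η) }

/-- The first Dirichlet eigenvalue of the Kohn-Laplacian on Ω, via the Rayleigh quotient. -/
def lam1 (Ω : Set H1) : ℝ :=
  sInf { q : ℝ | ∃ v : H1 → ℝ, ContDiff ℝ (⊤ : ℕ∞) v ∧ HasCompactSupport v ∧ tsupport v ⊆ Ω ∧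
    v ≠ 0 ∧ q = (∫ η in Ω, ((Xd v η) ^ 2 + (Yd v η) ^ 2)) / (∫ η in Ω, (v η) ^ 2) }

/-- The Bessel function of the first kind of order 1,
J₁(l) = (l/2)·Σ_{k=0}^∞ ((−1)^k/(k!·(k+1)!))·(l/2)^{2k}. -/
def J1 (l : ℝ) : ℝ :=
  (l / 2) * ∑' k : ℕ,
    ((-1 : ℝ) ^ k / ((Nat.factorial k : ℝ) * (Nat.factorial (k + 1) : ℝ))) * (l / 2) ^ (2 * k)

instance isAddHaarMeasure_volume_H1 : (volume : Measure H1).IsAddHaarMeasure := by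
  have : (volume : Measure (ℝ × ℝ)).IsAddHaarMeasure :=
    inferInstanceAs ((volume : Measure ℝ).prod (volume : Measure ℝ)).IsAddHaarMeasure
  exact inferInstanceAs ((volume : Measure ℝ).prod (volume : Measure (ℝ × ℝ))).IsAddHaarMeasure

/-! ### Horizontal calculus -/

/-- The horizontal inner product of the horizontal gradients of `u` and `v`. -/
def hdot (u v : H1 → ℝ) (η : H1) : ℝ := Xd u η * Xd v η + Yd u η * Yd v η

lemma Xd_congr {u v : H1 → ℝ} {η : H1} (h : u =ᶠ[nhds η] v) : Xd u η = Xd v η := by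
  simp only [Xd, h.fderiv_eq]

lemma Yd_congr {u v : H1 → ℝ} {η : H1} (h : u =ᶠ[nhds η] v) : Yd u η = Yd v η := by
  simp only [Yd, h.fderiv_eq]

lemma hdot_self_nonneg (u : H1 → ℝ) (η : H1) : 0 ≤ hdot u u η :=
  add_nonneg (mul_self_nonneg _) (mul_self_nonneg _)

lemma hdot_eq_zero_of_fderiv_eq_zero {u : H1 → ℝ} (v : H1 → ℝ) {η : H1}
    (h : fderiv ℝ u η = 0) : hdot u v η = 0 := by
  simp [hdot, Xd, Yd, h]

lemma hdot_comp {u : H1 → ℝ} (v : H1 → ℝ) {F : ℝ → ℝ} {c : ℝ} {η : H1}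
    (hu : DifferentiableAt ℝ u η) (hF : HasDerivAt F c (u η)) :
    hdot (fun z => F (u z)) v η = c * hdot u v η := by
  have := (hF.comp_hasFDerivAt η hu.hasFDerivAt).fderiv
  simp only [Function.comp_def] at this
  simp only [hdot, Xd, Yd, this, smul_apply, smul_eq_mul]
  ring

lemma hdot_comm (u v : H1 → ℝ) (η : H1) : hdot u v η = hdot v u η := by
  simp only [hdot]; ring

lemma hdot_sub_right {u v w : H1 → ℝ} {η : H1}
    (hv : DifferentiableAt ℝ v η) (hw : DifferentiableAt ℝ w η) :
    hdot u (fun z => v z - w z) η = hdot u v η - hdot u w η := by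
  have := (hv.hasFDerivAt.sub hw.hasFDerivAt).fderiv
  change fderiv ℝ (fun z => v z - w z) η = _ at this
  simp only [hdot, Xd, Yd, this, sub_apply]
  ring

lemma clm_apply_eq (L : H1 →L[ℝ] ℝ) (a b c : ℝ) : L (a, b, c) = L (a, b, 0) + c * L (0, 0, 1) := by
  have e : ((a, b, c) : H1) = (a, b, 0) + c • (0, 0, 1) := by simp
  rw [e, map_add, map_smul, smul_eq_mul]

lemma measurable_hdot (u v : H1 → ℝ) : Measurable (hdot u v) := by
  have key : ∀ w : H1 → ℝ, Measurable (Xd w) ∧ Measurable (Yd w) := by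
    intro w
    have hm := measurable_fderiv ℝ w
    constructor
    · have : Xd w = fun η => fderiv ℝ w η (1, 0, 0) + 2 * η.2.1 * fderiv ℝ w η (0, 0, 1) := by
        ext η
        rw [Xd, clm_apply_eq]
      rw [this]
      exact (hm.apply_continuousLinearMap _).add
        (by have := hm.apply_continuousLinearMap (0, 0, 1); fun_prop)
    · have : Yd w = fun η => fderiv ℝ w η (0, 1, 0) + -2 * η.1 * fderiv ℝ w η (0, 0, 1) := by
        ext η
        rw [Yd, clm_apply_eq]
      rw [this]
      exact (hm.apply_continuousLinearMap _).add
        (by have := hm.apply_continuousLinearMap (0, 0, 1); fun_prop)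
  exact ((key u).1.mul (key v).1).add ((key u).2.mul (key v).2)

lemma ContDiffOn.Xd {u : H1 → ℝ} {O : Set H1} {m n : WithTop ℕ∞} (hO : IsOpen O)
    (h : ContDiffOn ℝ n u O) (hmn : m + 1 ≤ n) : ContDiffOn ℝ m (Xd u) O :=
  (h.fderiv_of_isOpen hO hmn).clm_apply (by fun_prop)

lemma ContDiffOn.Yd {u : H1 → ℝ} {O : Set H1} {m n : WithTop ℕ∞} (hO : IsOpen O)
    (h : ContDiffOn ℝ n u O) (hmn : m + 1 ≤ n) : ContDiffOn ℝ m (Yd u) O :=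
  (h.fderiv_of_isOpen hO hmn).clm_apply (by fun_prop)

lemma Xd_mul {u v : H1 → ℝ} {η : H1} (hu : DifferentiableAt ℝ u η)
    (hv : DifferentiableAt ℝ v η) :
    Xd (fun z => u z * v z) η = u η * Xd v η + Xd u η * v η := by
  have := (hu.hasFDerivAt.mul hv.hasFDerivAt).fderiv
  change fderiv ℝ (fun z => u z * v z) η = _ at this
  simp only [Xd, this, add_apply, smul_apply, smul_eq_mul]
  ring

lemma Yd_mul {u v : H1 → ℝ} {η : H1} (hu : DifferentiableAt ℝ u η)
    (hv : DifferentiableAt ℝ v η) :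
    Yd (fun z => u z * v z) η = u η * Yd v η + Yd u η * v η := by
  have := (hu.hasFDerivAt.mul hv.hasFDerivAt).fderiv
  change fderiv ℝ (fun z => u z * v z) η = _ at this
  simp only [Yd, this, add_apply, smul_apply, smul_eq_mul]
  ring

/-! ### Integration by parts -/

lemma integrable_fderiv_apply {w : H1 → ℝ} (hw : ContDiff ℝ 1 w) (hc : HasCompactSupport w)
    (v : H1) : Integrable (fun η => fderiv ℝ w η v) :=
  ((hw.continuous_fderiv one_ne_zero).clm_apply continuous_const).integrable_of_hasCompactSupport
    (hc.fderiv_apply ℝ v)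

lemma integral_fderiv_apply_eq_zero {w : H1 → ℝ} (hw : ContDiff ℝ 1 w)
    (hc : HasCompactSupport w) (v : H1) : ∫ η, fderiv ℝ w η v = 0 := by
  have := integral_mul_fderiv_eq_neg_fderiv_mul_of_integrable (μ := (volume : Measure H1))
    (f := fun _ => (1 : ℝ)) (g := w) (v := v) (by simp)
    (by simpa using integrable_fderiv_apply hw hc v)
    (by simpa using hw.continuous.integrable_of_hasCompactSupport hc)
    (by simp) (fun x _ => hw.differentiable one_ne_zero x)
  simpa using this

lemma fderiv_mul_snd_eq {w : H1 → ℝ} {c : H1 → ℝ} (hw : ContDiff ℝ 1 w)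
    (hc : ContDiff ℝ 1 c) (η v : H1) (hv : fderiv ℝ c η v = 0) :
    fderiv ℝ (fun z => c z * w z) η v = c η * fderiv ℝ w η v := by
  have := ((hc.differentiable one_ne_zero η).hasFDerivAt.mul
    (hw.differentiable one_ne_zero η).hasFDerivAt).fderiv
  change fderiv ℝ (fun z => c z * w z) η = _ at this
  simp only [this, add_apply, smul_apply, smul_eq_mul, hv]
  ring

lemma integrable_Xd_and_integral_eq_zero {w : H1 → ℝ} (hw : ContDiff ℝ 1 w)
    (hc : HasCompactSupport w) : Integrable (Xd w) ∧ ∫ η, Xd w η = 0 := by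
  have hc2 : HasCompactSupport (fun z : H1 => 2 * z.2.1 * w z) := hc.mul_left
  have hw2 : ContDiff ℝ 1 (fun z : H1 => 2 * z.2.1 * w z) := by fun_prop
  have e : Xd w = fun η => fderiv ℝ w η (1, 0, 0) +
      fderiv ℝ (fun z : H1 => 2 * z.2.1 * w z) η (0, 0, 1) := by
    ext η
    have h1 : fderiv ℝ (fun z : H1 => 2 * z.2.1) η (0, 0, 1) = 0 := by
      have := ((2 : ℝ) • (ContinuousLinearMap.fst ℝ ℝ ℝ).comp
        (ContinuousLinearMap.snd ℝ ℝ (ℝ × ℝ))).fderiv (x := η)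
      change fderiv ℝ (fun z : H1 => 2 * z.2.1) η = _ at this
      rw [this]
      simp
    rw [fderiv_mul_snd_eq hw (by fun_prop) η _ h1, Xd, clm_apply_eq]
  rw [e]
  refine ⟨(integrable_fderiv_apply hw hc _).add (integrable_fderiv_apply hw2 hc2 _), ?_⟩
  rw [integral_add (integrable_fderiv_apply hw hc _) (integrable_fderiv_apply hw2 hc2 _),
    integral_fderiv_apply_eq_zero hw hc, integral_fderiv_apply_eq_zero hw2 hc2, add_zero]

lemma integrable_Yd_and_integral_eq_zero {w : H1 → ℝ} (hw : ContDiff ℝ 1 w)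
    (hc : HasCompactSupport w) : Integrable (Yd w) ∧ ∫ η, Yd w η = 0 := by
  have hc2 : HasCompactSupport (fun z : H1 => -2 * z.1 * w z) := hc.mul_left
  have hw2 : ContDiff ℝ 1 (fun z : H1 => -2 * z.1 * w z) := by fun_prop
  have e : Yd w = fun η => fderiv ℝ w η (0, 1, 0) +
      fderiv ℝ (fun z : H1 => -2 * z.1 * w z) η (0, 0, 1) := by
    ext η
    have h1 : fderiv ℝ (fun z : H1 => -2 * z.1) η (0, 0, 1) = 0 := by
      have := ((-2 : ℝ) • ContinuousLinearMap.fst ℝ ℝ (ℝ × ℝ)).fderiv (x := η)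
      change fderiv ℝ (fun z : H1 => -2 * z.1) η = _ at this
      rw [this]
      simp
    rw [fderiv_mul_snd_eq hw (by fun_prop) η _ h1, Yd, clm_apply_eq]
  rw [e]
  refine ⟨(integrable_fderiv_apply hw hc _).add (integrable_fderiv_apply hw2 hc2 _), ?_⟩
  rw [integral_add (integrable_fderiv_apply hw hc _) (integrable_fderiv_apply hw2 hc2 _),
    integral_fderiv_apply_eq_zero hw hc, integral_fderiv_apply_eq_zero hw2 hc2, add_zero]

/-- A product is smooth if both factors are smooth on an open set containing the topological
support of the first one. -/
lemma contDiff_mul_of_tsupport_subset {V h : H1 → ℝ} {O : Set H1} {n : WithTop ℕ∞}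
    (hV : ContDiff ℝ n V) (hO : IsOpen O) (hh : ContDiffOn ℝ n h O) (hs : tsupport V ⊆ O) :
    ContDiff ℝ n (fun η => V η * h η) := by
  rw [contDiff_iff_contDiffAt]
  intro η
  by_cases hη : η ∈ O
  · exact hV.contDiffAt.mul (hh.contDiffAt (hO.mem_nhds hη))
  · have : (fun z => V z * h z) =ᶠ[nhds η] fun _ => 0 := by
      filter_upwards [notMem_tsupport_iff_eventuallyEq.1 fun h => hη (hs h)] with z hz
      simp [hz]
    exact contDiffAt_const.congr_of_eventuallyEq this

/-- Green's formula for a compactly supported function and an `ℍ`-harmonic function. -/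
lemma integral_hdot_eq_zero {V h : H1 → ℝ} {O : Set H1} (hV : ContDiff ℝ 1 V)
    (hc : HasCompactSupport V) (hO : IsOpen O) (hh : ContDiffOn ℝ 2 h O)
    (hk : ∀ η ∈ O, kohn h η = 0) (hs : tsupport V ⊆ O) :
    Integrable (hdot V h) ∧ ∫ η, hdot V h η = 0 := by
  have hX := hh.Xd hO (m := 1) (by norm_num)
  have hY := hh.Yd hO (m := 1) (by norm_num)
  have hXc : HasCompactSupport fun η => V η * Xd h η := hc.mul_right
  have hYc : HasCompactSupport fun η => V η * Yd h η := hc.mul_right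
  obtain ⟨iX, zX⟩ := integrable_Xd_and_integral_eq_zero
    (contDiff_mul_of_tsupport_subset hV hO hX hs) hXc
  obtain ⟨iY, zY⟩ := integrable_Yd_and_integral_eq_zero
    (contDiff_mul_of_tsupport_subset hV hO hY hs) hYc
  have e : hdot V h = fun η => Xd (fun z => V z * Xd h z) η + Yd (fun z => V z * Yd h z) η := by
    ext η
    by_cases hη : η ∈ O
    · have hVη := hV.differentiable one_ne_zero η
      rw [Xd_mul hVη ((hX.contDiffAt (hO.mem_nhds hη)).differentiableAt one_ne_zero),
        Yd_mul hVη ((hY.contDiffAt (hO.mem_nhds hη)).differentiableAt one_ne_zero)]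
      have := hk η hη
      simp only [kohn] at this
      simp only [hdot]
      linear_combination (-V η) * this
    · have h0 := notMem_tsupport_iff_eventuallyEq.1 fun h => hη (hs h)
      have hX0 : (fun z => V z * Xd h z) =ᶠ[nhds η] fun _ => 0 := by
        filter_upwards [h0] with z hz
        simp [hz]
      have hY0 : (fun z => V z * Yd h z) =ᶠ[nhds η] fun _ => 0 := by
        filter_upwards [h0] with z hz
        simp [hz]
      rw [Xd_congr hX0, Yd_congr hY0, hdot, Xd_congr h0, Yd_congr h0]
      simp [Xd, Yd]
  rw [e]
  exact ⟨iX.add iY, by rw [integral_add iX iY, zX, zY, add_zero]⟩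

/-! ### Derivatives along horizontal lines -/

/-- The integral curve of `X` through `η`. -/
def lineX (η : H1) (s : ℝ) : H1 := (η.1 + s, η.2.1, η.2.2 + 2 * η.2.1 * s)

/-- The integral curve of `Y` through `η`. -/
def lineY (η : H1) (s : ℝ) : H1 := (η.1, η.2.1 + s, η.2.2 - 2 * η.1 * s)

lemma lineX_zero (η : H1) : lineX η 0 = η := by simp [lineX]

lemma lineY_zero (η : H1) : lineY η 0 = η := by simp [lineY]

lemma continuous_lineX (η : H1) : Continuous (lineX η) := by unfold lineX; fun_prop

lemma continuous_lineY (η : H1) : Continuous (lineY η) := by unfold lineY; fun_prop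

lemma hasDerivAt_comp_lineX {u : H1 → ℝ} {η : H1} {s : ℝ}
    (hu : DifferentiableAt ℝ u (lineX η s)) :
    HasDerivAt (fun s => u (lineX η s)) (Xd u (lineX η s)) s := by
  have h : HasDerivAt (lineX η) (1, 0, 2 * η.2.1) s := by
    refine ((hasDerivAt_id s).const_add _).prodMk ((hasDerivAt_const _ _).prodMk ?_)
    simpa using ((hasDerivAt_id s).const_mul (2 * η.2.1)).const_add η.2.2
  exact hu.hasFDerivAt.comp_hasDerivAt s h

lemma hasDerivAt_comp_lineY {u : H1 → ℝ} {η : H1} {s : ℝ}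
    (hu : DifferentiableAt ℝ u (lineY η s)) :
    HasDerivAt (fun s => u (lineY η s)) (Yd u (lineY η s)) s := by
  have h : HasDerivAt (lineY η) (0, 1, -2 * η.1) s := by
    refine (hasDerivAt_const _ _).prodMk (((hasDerivAt_id s).const_add _).prodMk ?_)
    simpa using ((hasDerivAt_id s).const_mul (2 * η.1)).const_sub η.2.2
  exact hu.hasFDerivAt.comp_hasDerivAt s h

lemma Xd_eq_of_hasDerivAt {u : H1 → ℝ} {η : H1} {c : ℝ} (hu : DifferentiableAt ℝ u η)
    (h : HasDerivAt (fun s => u (lineX η s)) c 0) : Xd u η = c := by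
  have := hasDerivAt_comp_lineX (η := η) (s := 0) (by rwa [lineX_zero])
  rw [lineX_zero] at this
  exact this.unique h

lemma Yd_eq_of_hasDerivAt {u : H1 → ℝ} {η : H1} {c : ℝ} (hu : DifferentiableAt ℝ u η)
    (h : HasDerivAt (fun s => u (lineY η s)) c 0) : Yd u η = c := by
  have := hasDerivAt_comp_lineY (η := η) (s := 0) (by rwa [lineY_zero])
  rw [lineY_zero] at this
  exact this.unique h

lemma Xd_comp {u : H1 → ℝ} {F : ℝ → ℝ} {c : ℝ} {η : H1}
    (hu : DifferentiableAt ℝ u η) (hF : HasDerivAt F c (u η)) :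
    Xd (fun z => F (u z)) η = c * Xd u η := by
  have := (hF.comp_hasFDerivAt η hu.hasFDerivAt).fderiv
  simp only [Function.comp_def] at this
  simp [Xd, this]

lemma Yd_comp {u : H1 → ℝ} {F : ℝ → ℝ} {c : ℝ} {η : H1}
    (hu : DifferentiableAt ℝ u η) (hF : HasDerivAt F c (u η)) :
    Yd (fun z => F (u z)) η = c * Yd u η := by
  have := (hF.comp_hasFDerivAt η hu.hasFDerivAt).fderiv
  simp only [Function.comp_def] at this
  simp [Yd, this]

/-! ### The fundamental solution -/

/-- The fourth power of the Koranyi distance. -/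
def kquart (ξ η : H1) : ℝ :=
  ((η.1 - ξ.1) ^ 2 + (η.2.1 - ξ.2.1) ^ 2) ^ 2 +
    (η.2.2 - ξ.2.2 + 2 * (ξ.1 * η.2.1 - η.1 * ξ.2.1)) ^ 2

lemma kquart_nonneg (ξ η : H1) : 0 ≤ kquart ξ η := by unfold kquart; positivity

lemma kquart_self (ξ : H1) : kquart ξ ξ = 0 := by
  simp [kquart, mul_comm]

lemma kquart_pos {ξ η : H1} (h : η ≠ ξ) : 0 < kquart ξ η := by
  refine (kquart_nonneg ξ η).lt_of_ne' fun h0 => h ?_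
  unfold kquart at h0
  have h1 : (η.1 - ξ.1) ^ 2 + (η.2.1 - ξ.2.1) ^ 2 = 0 := by
    nlinarith [sq_nonneg ((η.1 - ξ.1) ^ 2 + (η.2.1 - ξ.2.1) ^ 2),
      sq_nonneg (η.2.2 - ξ.2.2 + 2 * (ξ.1 * η.2.1 - η.1 * ξ.2.1))]
  have hx : η.1 = ξ.1 := by nlinarith [sq_nonneg (η.1 - ξ.1), sq_nonneg (η.2.1 - ξ.2.1)]
  have hy : η.2.1 = ξ.2.1 := by nlinarith [sq_nonneg (η.1 - ξ.1), sq_nonneg (η.2.1 - ξ.2.1)]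
  rw [hx, hy] at h0
  have ht : η.2.2 = ξ.2.2 := by nlinarith
  exact Prod.ext hx (Prod.ext hy ht)

lemma contDiff_kquart (ξ : H1) {n : WithTop ℕ∞} : ContDiff ℝ n (kquart ξ) := by
  unfold kquart; fun_prop

lemma kd_eq (ξ η : H1) : kd ξ η = kquart ξ η ^ (1 / 4 : ℝ) := by
  simp only [kd, ρH, hmul, hinv, kquart]
  congr 1
  ring

lemma kd_sq (ξ η : H1) : kd ξ η ^ 2 = √(kquart ξ η) := by
  rw [kd_eq, ← Real.rpow_natCast, ← Real.rpow_mul (kquart_nonneg ξ η), Real.sqrt_eq_rpow]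
  norm_num

lemma continuous_kd_sq (ξ : H1) : Continuous fun η => kd ξ η ^ 2 := by
  simp only [kd_sq]
  exact (contDiff_kquart (n := 0) ξ).continuous.sqrt

lemma kd_self (ξ : H1) : kd ξ ξ = 0 := by
  rw [kd_eq, kquart_self]
  exact Real.zero_rpow (by norm_num)

lemma kd_sq_pos {ξ η : H1} (h : η ≠ ξ) : 0 < kd ξ η ^ 2 := by
  rw [kd_sq]; exact Real.sqrt_pos.2 (kquart_pos h)

lemma Γξ_eq (ξ η : H1) : Γξ ξ η = (8 * π)⁻¹ * kquart ξ η ^ (-1 / 2 : ℝ) := by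
  rw [Γξ, kd_sq, one_div, mul_inv, Real.sqrt_eq_rpow, ← Real.rpow_neg (kquart_nonneg ξ η)]
  norm_num

lemma contDiffOn_Γξ (ξ : H1) {n : WithTop ℕ∞} : ContDiffOn ℝ n (Γξ ξ) {ξ}ᶜ := by
  intro η hη
  rw [funext (Γξ_eq ξ)]
  exact (contDiffAt_const.mul ((contDiff_kquart ξ).contDiffAt.rpow_const_of_ne
    (kquart_pos hη).ne')).contDiffWithinAt

lemma Xd_kquart (ξ η : H1) : Xd (kquart ξ) η =
    4 * ((η.1 - ξ.1) * ((η.1 - ξ.1) ^ 2 + (η.2.1 - ξ.2.1) ^ 2) +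
      (η.2.1 - ξ.2.1) * (η.2.2 - ξ.2.2 + 2 * (ξ.1 * η.2.1 - η.1 * ξ.2.1))) := by
  refine Xd_eq_of_hasDerivAt ((contDiff_kquart (n := 1) ξ).differentiable one_ne_zero η) ?_
  simp only [kquart, lineX]
  have h0 := hasDerivAt_id (0 : ℝ)
  have h1 := (((h0.const_add η.1).sub_const ξ.1).pow 2).add_const ((η.2.1 - ξ.2.1) ^ 2)
  have h2 := (((h0.const_mul (2 * η.2.1)).const_add η.2.2).sub_const ξ.2.2).add
    ((((h0.const_add η.1).mul_const ξ.2.1).const_sub (ξ.1 * η.2.1)).const_mul 2)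
  refine ((h1.pow 2).add (h2.pow 2)).congr_deriv ?_
  simp
  ring

lemma Yd_kquart (ξ η : H1) : Yd (kquart ξ) η =
    4 * ((η.2.1 - ξ.2.1) * ((η.1 - ξ.1) ^ 2 + (η.2.1 - ξ.2.1) ^ 2) -
      (η.1 - ξ.1) * (η.2.2 - ξ.2.2 + 2 * (ξ.1 * η.2.1 - η.1 * ξ.2.1))) := by
  refine Yd_eq_of_hasDerivAt ((contDiff_kquart (n := 1) ξ).differentiable one_ne_zero η) ?_
  simp only [kquart, lineY]
  have h0 := hasDerivAt_id (0 : ℝ)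
  have h1 := (((h0.const_add η.2.1).sub_const ξ.2.1).pow 2).const_add ((η.1 - ξ.1) ^ 2)
  have h2 := (((h0.const_mul (2 * η.1)).const_sub η.2.2).sub_const ξ.2.2).add
    ((((h0.const_add η.2.1).const_mul ξ.1).sub_const (η.1 * ξ.2.1)).const_mul 2)
  refine ((h1.pow 2).add (h2.pow 2)).congr_deriv ?_
  simp
  ring

lemma Xd_Xd_kquart (ξ η : H1) : Xd (Xd (kquart ξ)) η =
    12 * ((η.1 - ξ.1) ^ 2 + (η.2.1 - ξ.2.1) ^ 2) := by
  rw [funext (Xd_kquart ξ)]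
  refine Xd_eq_of_hasDerivAt (by fun_prop) ?_
  simp only [lineX]
  have h0 := hasDerivAt_id (0 : ℝ)
  have h1 := (((h0.const_add η.1).sub_const ξ.1).pow 2).add_const ((η.2.1 - ξ.2.1) ^ 2)
  have h2 := (((h0.const_mul (2 * η.2.1)).const_add η.2.2).sub_const ξ.2.2).add
    ((((h0.const_add η.1).mul_const ξ.2.1).const_sub (ξ.1 * η.2.1)).const_mul 2)
  refine (((((h0.const_add η.1).sub_const ξ.1).mul h1).add
    (h2.const_mul (η.2.1 - ξ.2.1))).const_mul 4).congr_deriv ?_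
  simp
  ring

lemma Yd_Yd_kquart (ξ η : H1) : Yd (Yd (kquart ξ)) η =
    12 * ((η.1 - ξ.1) ^ 2 + (η.2.1 - ξ.2.1) ^ 2) := by
  rw [funext (Yd_kquart ξ)]
  refine Yd_eq_of_hasDerivAt (by fun_prop) ?_
  simp only [lineY]
  have h0 := hasDerivAt_id (0 : ℝ)
  have h1 := (((h0.const_add η.2.1).sub_const ξ.2.1).pow 2).const_add ((η.1 - ξ.1) ^ 2)
  have h2 := (((h0.const_mul (2 * η.1)).const_sub η.2.2).sub_const ξ.2.2).add
    ((((h0.const_add η.2.1).const_mul ξ.1).sub_const (η.1 * ξ.2.1)).const_mul 2)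
  refine (((((h0.const_add η.2.1).sub_const ξ.2.1).mul h1).sub
    (h2.const_mul (η.1 - ξ.1))).const_mul 4).congr_deriv ?_
  simp
  ring

/-- The Koranyi fundamental solution is `ℍ`-harmonic away from its pole. -/
lemma kohn_Γξ {ξ η : H1} (h : η ≠ ξ) : kohn (Γξ ξ) η = 0 := by
  have hQ (z : H1) := (contDiff_kquart (n := 1) ξ).differentiable one_ne_zero z
  have hXQ (z : H1) : DifferentiableAt ℝ (Xd (kquart ξ)) z := by
    rw [funext (Xd_kquart ξ)]; fun_prop
  have hYQ (z : H1) : DifferentiableAt ℝ (Yd (kquart ξ)) z := by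
    rw [funext (Yd_kquart ξ)]; fun_prop
  have hd (p : ℝ) (z : H1) (hz : z ≠ ξ) :
      HasDerivAt (fun s : ℝ => s ^ p) (p * kquart ξ z ^ (p - 1)) (kquart ξ z) :=
    Real.hasDerivAt_rpow_const (Or.inl (kquart_pos hz).ne')
  have hG (z : H1) (hz : z ≠ ξ) : HasDerivAt (fun s : ℝ => (8 * π)⁻¹ * s ^ (-1 / 2 : ℝ))
      ((8 * π)⁻¹ * (-1 / 2 * kquart ξ z ^ (-3 / 2 : ℝ))) (kquart ξ z) := by
    refine ((hd (-1 / 2) z hz).const_mul (8 * π)⁻¹).congr_deriv ?_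
    norm_num
  have hG2 : HasDerivAt (fun s : ℝ => (8 * π)⁻¹ * (-1 / 2 * s ^ (-3 / 2 : ℝ)))
      ((8 * π)⁻¹ * (-1 / 2 * (-3 / 2 * kquart ξ η ^ (-5 / 2 : ℝ)))) (kquart ξ η) := by
    refine (((hd (-3 / 2) η h).const_mul (-1 / 2)).const_mul (8 * π)⁻¹).congr_deriv ?_
    norm_num
  have hP : DifferentiableAt ℝ (fun z => (8 * π)⁻¹ * (-1 / 2 * kquart ξ z ^ (-3 / 2 : ℝ))) η :=
    hG2.differentiableAt.comp η (hQ η)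
  have hnhds : ∀ᶠ z in nhds η, z ≠ ξ := isOpen_ne.mem_nhds h
  have eX : Xd (Γξ ξ) =ᶠ[nhds η] fun z =>
      (8 * π)⁻¹ * (-1 / 2 * kquart ξ z ^ (-3 / 2 : ℝ)) * Xd (kquart ξ) z := by
    filter_upwards [hnhds] with z hz
    rw [funext (Γξ_eq ξ)]
    exact Xd_comp (hQ z) (hG z hz)
  have eY : Yd (Γξ ξ) =ᶠ[nhds η] fun z =>
      (8 * π)⁻¹ * (-1 / 2 * kquart ξ z ^ (-3 / 2 : ℝ)) * Yd (kquart ξ) z := by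
    filter_upwards [hnhds] with z hz
    rw [funext (Γξ_eq ξ)]
    exact Yd_comp (hQ z) (hG z hz)
  rw [kohn, Xd_congr eX, Yd_congr eY, Xd_mul hP (hXQ η), Yd_mul hP (hYQ η),
    Xd_comp (hQ η) hG2, Yd_comp (hQ η) hG2, Xd_Xd_kquart, Yd_Yd_kquart, Xd_kquart, Yd_kquart]
  have e : kquart ξ η ^ (-3 / 2 : ℝ) = kquart ξ η * kquart ξ η ^ (-5 / 2 : ℝ) := by
    rw [← Real.rpow_one_add' (kquart_nonneg ξ η) (by norm_num)]
    norm_num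
  rw [e]
  generalize kquart ξ η ^ (-5 / 2 : ℝ) = a
  rw [kquart]
  ring

/-! ### Regular parts of Green's functions and the minimum principle -/

/-- `H` is a regular part of the Green's function of the bounded open set `Ω` at `ξ`. -/
structure IsRegularPart (Ω : Set H1) (ξ : H1) (H : H1 → ℝ) : Prop where
  isOpen : IsOpen Ω
  isBounded : Bornology.IsBounded Ω
  mem : ξ ∈ Ω
  continuousOn : ContinuousOn H (closure Ω)
  contDiffOn : ContDiffOn ℝ 2 H Ω
  kohn_eq_zero : ∀ η ∈ Ω, kohn H η = 0
  eq_Γξ : ∀ η ∈ frontier Ω, H η = Γξ ξ η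

lemma IsLocalMin.deriv_deriv_nonneg {f : ℝ → ℝ} {s : ℝ} (h : IsLocalMin f s)
    (hc : ContinuousAt f s) : 0 ≤ deriv (deriv f) s := by
  by_contra! hneg
  have hmax := isLocalMax_of_deriv_deriv_neg hneg h.deriv_eq_zero hc
  have he : f =ᶠ[nhds s] fun _ => f s := by
    filter_upwards [h, hmax] with x h1 h2 using le_antisymm h2 h1
  have := he.deriv.deriv_eq
  simp at this
  exact hneg.ne this

lemma IsLocalMin.Xd_Xd_nonneg {v : H1 → ℝ} {O : Set H1} {η : H1} (h : IsLocalMin v η)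
    (hO : IsOpen O) (hv : ContDiffOn ℝ 2 v O) (hη : η ∈ O) : 0 ≤ Xd (Xd v) η := by
  have hd (z : H1) (hz : z ∈ O) : DifferentiableAt ℝ v z :=
    (hv.contDiffAt (hO.mem_nhds hz)).differentiableAt two_ne_zero
  have ht : Filter.Tendsto (lineX η) (nhds 0) (nhds η) := by
    simpa only [lineX_zero] using (continuous_lineX η).tendsto 0
  have hX : DifferentiableAt ℝ (Xd v) (lineX η 0) := by
    rw [lineX_zero]
    exact ((hv.Xd hO (m := 1) (by norm_num)).contDiffAt (hO.mem_nhds hη)).differentiableAt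
      one_ne_zero
  have e1 : deriv (fun s => v (lineX η s)) =ᶠ[nhds 0] fun s => Xd v (lineX η s) := by
    filter_upwards [ht (hO.mem_nhds hη)] with s hs
    exact (hasDerivAt_comp_lineX (hd _ hs)).deriv
  have hmin : IsLocalMin (fun s => v (lineX η s)) 0 := by
    filter_upwards [ht h] with s hs
    simpa only [lineX_zero, mem_preimage, mem_ofPred_eq] using hs
  have hc : ContinuousAt (fun s => v (lineX η s)) 0 :=
    (hasDerivAt_comp_lineX (hd _ (by rwa [lineX_zero]))).continuousAt
  have := hmin.deriv_deriv_nonneg hc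
  rwa [e1.deriv_eq, (hasDerivAt_comp_lineX hX).deriv, lineX_zero] at this

lemma IsLocalMin.Yd_Yd_nonneg {v : H1 → ℝ} {O : Set H1} {η : H1} (h : IsLocalMin v η)
    (hO : IsOpen O) (hv : ContDiffOn ℝ 2 v O) (hη : η ∈ O) : 0 ≤ Yd (Yd v) η := by
  have hd (z : H1) (hz : z ∈ O) : DifferentiableAt ℝ v z :=
    (hv.contDiffAt (hO.mem_nhds hz)).differentiableAt two_ne_zero
  have ht : Filter.Tendsto (lineY η) (nhds 0) (nhds η) := by
    simpa only [lineY_zero] using (continuous_lineY η).tendsto 0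
  have hY : DifferentiableAt ℝ (Yd v) (lineY η 0) := by
    rw [lineY_zero]
    exact ((hv.Yd hO (m := 1) (by norm_num)).contDiffAt (hO.mem_nhds hη)).differentiableAt
      one_ne_zero
  have e1 : deriv (fun s => v (lineY η s)) =ᶠ[nhds 0] fun s => Yd v (lineY η s) := by
    filter_upwards [ht (hO.mem_nhds hη)] with s hs
    exact (hasDerivAt_comp_lineY (hd _ hs)).deriv
  have hmin : IsLocalMin (fun s => v (lineY η s)) 0 := by
    filter_upwards [ht h] with s hs
    simpa only [lineY_zero, mem_preimage, mem_ofPred_eq] using hs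
  have hc : ContinuousAt (fun s => v (lineY η s)) 0 :=
    (hasDerivAt_comp_lineY (hd _ (by rwa [lineY_zero]))).continuousAt
  have := hmin.deriv_deriv_nonneg hc
  rwa [e1.deriv_eq, (hasDerivAt_comp_lineY hY).deriv, lineY_zero] at this

lemma Xd_sub {u v : H1 → ℝ} {η : H1} (hu : DifferentiableAt ℝ u η)
    (hv : DifferentiableAt ℝ v η) : Xd (fun z => u z - v z) η = Xd u η - Xd v η := by
  have := (hu.hasFDerivAt.sub hv.hasFDerivAt).fderiv
  change fderiv ℝ (fun z => u z - v z) η = _ at this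
  simp only [Xd, this, sub_apply]

lemma Yd_sub {u v : H1 → ℝ} {η : H1} (hu : DifferentiableAt ℝ u η)
    (hv : DifferentiableAt ℝ v η) : Yd (fun z => u z - v z) η = Yd u η - Yd v η := by
  have := (hu.hasFDerivAt.sub hv.hasFDerivAt).fderiv
  change fderiv ℝ (fun z => u z - v z) η = _ at this
  simp only [Yd, this, sub_apply]

lemma kohn_sub {u v : H1 → ℝ} {O : Set H1} {η : H1} (hO : IsOpen O)
    (hu : ContDiffOn ℝ 2 u O) (hv : ContDiffOn ℝ 2 v O) (hη : η ∈ O) :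
    kohn (fun z => u z - v z) η = kohn u η - kohn v η := by
  have hd {n : WithTop ℕ∞} {w : H1 → ℝ} (hw : ContDiffOn ℝ n w O) (hn : n ≠ 0) (z : H1)
      (hz : z ∈ O) : DifferentiableAt ℝ w z :=
    (hw.contDiffAt (hO.mem_nhds hz)).differentiableAt hn
  have h1 : (1 : WithTop ℕ∞) + 1 ≤ 2 := by norm_num
  have eX : Xd (fun z => u z - v z) =ᶠ[nhds η] fun z => Xd u z - Xd v z := by
    filter_upwards [hO.mem_nhds hη] with z hz
    exact Xd_sub (hd hu two_ne_zero z hz) (hd hv two_ne_zero z hz)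
  have eY : Yd (fun z => u z - v z) =ᶠ[nhds η] fun z => Yd u z - Yd v z := by
    filter_upwards [hO.mem_nhds hη] with z hz
    exact Yd_sub (hd hu two_ne_zero z hz) (hd hv two_ne_zero z hz)
  rw [kohn, Xd_congr eX, Yd_congr eY,
    Xd_sub (hd (hu.Xd hO h1) one_ne_zero η hη) (hd (hv.Xd hO h1) one_ne_zero η hη),
    Yd_sub (hd (hu.Yd hO h1) one_ne_zero η hη) (hd (hv.Yd hO h1) one_ne_zero η hη), kohn, kohn]
  ring

lemma kohn_const_mul_sq (ε : ℝ) (η : H1) : kohn (fun z => ε * z.1 ^ 2) η = 2 * ε := by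
  have h0 := hasDerivAt_id (0 : ℝ)
  have eX (z : H1) : Xd (fun z => ε * z.1 ^ 2) z = ε * (2 * z.1) := by
    refine Xd_eq_of_hasDerivAt (by fun_prop) ?_
    refine (((h0.const_add z.1).pow 2).const_mul ε).congr_deriv ?_
    simp
  have eY (z : H1) : Yd (fun z => ε * z.1 ^ 2) z = 0 :=
    Yd_eq_of_hasDerivAt (by fun_prop) (hasDerivAt_const (0 : ℝ) (ε * z.1 ^ 2))
  have eXX : Xd (fun z : H1 => ε * (2 * z.1)) η = 2 * ε := by
    refine Xd_eq_of_hasDerivAt (by fun_prop) ?_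
    refine (((h0.const_add η.1).const_mul 2).const_mul ε).congr_deriv ?_
    ring
  rw [kohn, funext eX, funext eY, eXX]
  simp [Yd]

namespace IsRegularPart

variable {Ω : Set H1} {ξ : H1} {H : H1 → ℝ}

lemma isOpen_diff (h : IsRegularPart Ω ξ H) : IsOpen (Ω \ {ξ}) :=
  h.isOpen.sdiff isClosed_singleton

lemma contDiffOn_green (h : IsRegularPart Ω ξ H) :
    ContDiffOn ℝ 2 (fun η => Γξ ξ η - H η) (Ω \ {ξ}) :=
  ((contDiffOn_Γξ ξ).mono fun _ hz => hz.2).sub (h.contDiffOn.mono sdiff_subset)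

/-- The Green's function is nonnegative. -/
lemma le_Γξ (h : IsRegularPart Ω ξ H) {η : H1} (hη : η ∈ Ω) (hne : η ≠ ξ) :
    H η ≤ Γξ ξ η := by
  by_contra! hlt
  have hcpt : IsCompact (closure Ω) := h.isBounded.isCompact_closure
  obtain ⟨M, hM0, hM⟩ : ∃ M > 0, ∀ z ∈ closure Ω, H z ≤ M := by
    obtain ⟨M, hM⟩ := hcpt.bddAbove_image h.continuousOn
    exact ⟨max M 1, by positivity, fun z hz => (hM ⟨z, hz, rfl⟩).trans (le_max_left _ _)⟩
  obtain ⟨C, hC0, hC⟩ : ∃ C > 0, ∀ z ∈ closure Ω, z.1 ^ 2 ≤ C := by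
    obtain ⟨C, hC⟩ := hcpt.bddAbove_image (f := fun z : H1 => z.1 ^ 2) (by fun_prop)
    exact ⟨max C 1, by positivity, fun z hz => (hC ⟨z, hz, rfl⟩).trans (le_max_left _ _)⟩
  set δ : ℝ := min (kd ξ η ^ 2) (1 / (8 * π * M))
  have hδ : 0 < δ := lt_min (kd_sq_pos hne) (by positivity)
  set ε : ℝ := (H η - Γξ ξ η) / (2 * C)
  have hε : 0 < ε := div_pos (sub_pos.2 hlt) (by positivity)
  have hεC : ε * C = (H η - Γξ ξ η) / 2 := by simp only [ε]; field_simp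
  set v : H1 → ℝ := fun z => Γξ ξ z - H z - ε * z.1 ^ 2 with hv
  have hne_of {z : H1} (hz : δ ≤ kd ξ z ^ 2) : z ≠ ξ := by
    rintro rfl
    rw [kd_self] at hz
    norm_num at hz
    linarith
  have hηK : η ∈ closure Ω ∩ {z | δ ≤ kd ξ z ^ 2} :=
    ⟨subset_closure hη, min_le_left (kd ξ η ^ 2) _⟩
  have hK : IsCompact (closure Ω ∩ {z | δ ≤ kd ξ z ^ 2}) :=
    hcpt.inter_right (isClosed_le continuous_const (continuous_kd_sq ξ))
  have hvc : ContinuousOn v (closure Ω ∩ {z | δ ≤ kd ξ z ^ 2}) := by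
    refine ContinuousOn.sub (ContinuousOn.sub ?_ (h.continuousOn.mono inter_subset_left))
      (by fun_prop)
    exact (contDiffOn_Γξ ξ (n := 0)).continuousOn.mono fun z hz => hne_of hz.2
  obtain ⟨z, ⟨hzc, hzδ⟩, hz⟩ := hK.exists_isMinOn ⟨η, hηK⟩ hvc
  have hvz : v z < -(ε * C) := by
    have h1 : v z ≤ v η := hz hηK
    have h2 : 0 ≤ ε * η.1 ^ 2 := by positivity
    simp only [hv] at h1 ⊢
    linarith
  have hGz : Γξ ξ z - H z < 0 := by
    have := mul_le_mul_of_nonneg_left (hC z hzc) hε.le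
    simp only [hv] at hvz
    linarith
  have hzΩ : z ∈ Ω := by
    by_contra hzn
    have := h.eq_Γξ z ⟨hzc, by rwa [h.isOpen.interior_eq]⟩
    linarith
  have hzlt : δ < kd ξ z ^ 2 := by
    refine lt_of_le_of_ne hzδ fun heq => ?_
    have h1 : δ ≤ 1 / (8 * π * M) := min_le_right _ _
    have h2 : M ≤ Γξ ξ z := by
      rw [Γξ, ← heq, le_div_iff₀ (by positivity)]
      rw [le_div_iff₀ (by positivity)] at h1
      linarith
    linarith [hM z hzc]
  have hO : IsOpen (Ω ∩ {z | δ < kd ξ z ^ 2}) :=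
    h.isOpen.inter (isOpen_lt continuous_const (continuous_kd_sq ξ))
  have hmin : IsLocalMin v z := by
    filter_upwards [hO.mem_nhds ⟨hzΩ, hzlt⟩] with w hw
    have hw2 : δ < kd ξ w ^ 2 := hw.2
    exact hz ⟨subset_closure hw.1, hw2.le⟩
  have hzO : z ∈ Ω \ {ξ} := ⟨hzΩ, hne_of hzδ⟩
  have hsq : ContDiffOn ℝ 2 (fun z : H1 => ε * z.1 ^ 2) (Ω \ {ξ}) := by fun_prop
  have hvd : ContDiffOn ℝ 2 v (Ω \ {ξ}) := h.contDiffOn_green.sub hsq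
  have hX := hmin.Xd_Xd_nonneg h.isOpen_diff hvd hzO
  have hY := hmin.Yd_Yd_nonneg h.isOpen_diff hvd hzO
  have hk : kohn v z = 0 - 0 - 2 * ε := by
    rw [hv, kohn_sub h.isOpen_diff h.contDiffOn_green hsq hzO,
      kohn_sub h.isOpen_diff ((contDiffOn_Γξ ξ).mono fun _ hz => hz.2)
        (h.contDiffOn.mono sdiff_subset) hzO, kohn_Γξ hzO.2, h.kohn_eq_zero z hzΩ,
      kohn_const_mul_sq]
  rw [kohn] at hk
  linarith

end IsRegularPart

/-! ### The Dirichlet integral of truncations of the Green's function -/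

lemma hdot_eq_zero_of_eventuallyEq_const {u : H1 → ℝ} {c : ℝ} {η : H1} (h : u =ᶠ[nhds η] fun _ => c) :
    Xd u =ᶠ[nhds η] 0 ∧ Yd u =ᶠ[nhds η] 0 := by
  have := h.fderiv (𝕜 := ℝ)
  constructor <;> filter_upwards [this] with z hz <;> simp [Xd, Yd, hz]

/-- The pairing of a compactly supported function, constant near the pole, with the fundamental
solution is integrable. -/
lemma integrable_hdot_Γξ {W : H1 → ℝ} {ξ : H1} {c : ℝ} (hW : ContDiff ℝ 1 W)
    (hc : HasCompactSupport W) (hξ : W =ᶠ[nhds ξ] fun _ => c) : Integrable (hdot W (Γξ ξ)) := by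
  have hΓ := contDiffOn_Γξ ξ (n := 1)
  have hO : IsOpen ({ξ}ᶜ : Set H1) := isOpen_compl_singleton
  have hW' : ContDiffOn ℝ 1 W univ := hW.contDiffOn
  have hX : ContDiff ℝ 0 (Xd W) := contDiffOn_univ.1 (hW'.Xd isOpen_univ (by norm_num))
  have hY : ContDiff ℝ 0 (Yd W) := contDiffOn_univ.1 (hW'.Yd isOpen_univ (by norm_num))
  have hXs : tsupport (Xd W) ⊆ {ξ}ᶜ := by
    rintro z hz rfl
    exact notMem_tsupport_iff_eventuallyEq.2 (hdot_eq_zero_of_eventuallyEq_const hξ).1 hz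
  have hYs : tsupport (Yd W) ⊆ {ξ}ᶜ := by
    rintro z hz rfl
    exact notMem_tsupport_iff_eventuallyEq.2 (hdot_eq_zero_of_eventuallyEq_const hξ).2 hz
  have hXc : HasCompactSupport (Xd W) := (hc.fderiv (𝕜 := ℝ)).mono fun z hz hz0 => hz (by
    simp [Xd, hz0])
  have hYc : HasCompactSupport (Yd W) := (hc.fderiv (𝕜 := ℝ)).mono fun z hz hz0 => hz (by
    simp [Yd, hz0])
  refine Continuous.integrable_of_hasCompactSupport (Continuous.add ?_ ?_)
    (HasCompactSupport.add hXc.mul_right hYc.mul_right)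
  · exact (contDiff_mul_of_tsupport_subset hX hO (hΓ.Xd hO (by norm_num)) hXs).continuous
  · exact (contDiff_mul_of_tsupport_subset hY hO (hΓ.Yd hO (by norm_num)) hYs).continuous

namespace IsRegularPart

variable {Ω : Set H1} {ξ : H1} {H : H1 → ℝ}

lemma lt_green_iff {η : H1} (hne : η ≠ ξ) (a : ℝ) :
    8 * π * kd ξ η ^ 2 * (H η + a) < 1 ↔ a < Γξ ξ η - H η := by
  rw [Γξ, lt_sub_iff_add_lt, lt_div_iff₀ (mul_pos (by positivity) (kd_sq_pos hne))]
  constructor <;> intro <;> linarith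

lemma exists_truncation (h : IsRegularPart Ω ξ H) {F : ℝ → ℝ} (hF : ContDiff ℝ 1 F) {a b c : ℝ}
    (ha : 0 < a) (hFa : ∀ s ≤ a, F s = 0) (hFb : ∀ s, b ≤ s → F s = c) :
    ∃ W : H1 → ℝ, ContDiff ℝ 1 W ∧ HasCompactSupport W ∧ tsupport W ⊆ Ω ∧
      (W =ᶠ[nhds ξ] fun _ => c) ∧
      ∀ η ∈ Ω \ {ξ}, W =ᶠ[nhds η] fun z => F (Γξ ξ z - H z) := by
  classical
  set W : H1 → ℝ := fun η => if η ∈ Ω then (if η = ξ then c else F (Γξ ξ η - H η)) else 0 with hW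
  set K : Set H1 := closure Ω ∩ {η | 8 * π * kd ξ η ^ 2 * (H η + a) ≤ 1} with hKdef
  have hcont (b : ℝ) : ContinuousOn (fun η => 8 * π * kd ξ η ^ 2 * (H η + b)) (closure Ω) :=
    (continuous_const.mul (continuous_kd_sq ξ)).continuousOn.mul
      (h.continuousOn.add continuousOn_const)
  have hKc : IsClosed K := (hcont a).preimage_isClosed_of_isClosed isClosed_closure isClosed_Iic
  have hKcpt : IsCompact K := h.isBounded.isCompact_closure.of_isClosed_subset hKc
    inter_subset_left
  have hKΩ : K ⊆ Ω := by
    rintro z ⟨hz, hz1⟩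
    by_contra hzn
    have hne : z ≠ ξ := fun h0 => hzn (h0 ▸ h.mem)
    have e := h.eq_Γξ z ⟨hz, by rwa [h.isOpen.interior_eq]⟩
    have hz2 : 8 * π * kd ξ z ^ 2 * (H z + a) ≤ 1 := hz1
    refine absurd hz2 (not_le.2 ?_)
    have := kd_sq_pos hne
    rw [e, Γξ, mul_add, mul_one_div_cancel (by positivity)]
    have : 0 < 8 * π * kd ξ z ^ 2 * a := by positivity
    linarith
  have hWK (z : H1) (hz : z ∉ K) : W z = 0 := by
    by_cases hzΩ : z ∈ Ω
    · have hz1 : ¬ 8 * π * kd ξ z ^ 2 * (H z + a) ≤ 1 := fun h1 => hz ⟨subset_closure hzΩ, h1⟩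
      have hne : z ≠ ξ := by
        rintro rfl
        simp [kd_self] at hz1
      simp only [hW, hzΩ, hne, if_true, if_false]
      exact hFa _ (not_lt.1 fun h1 => hz1 ((lt_green_iff hne a).2 h1).le)
    · simp [hW, hzΩ]
  have hsupp : tsupport W ⊆ K := closure_minimal
    (fun z hz => by_contra fun h0 => hz (hWK z h0)) hKc
  have hWξ : W =ᶠ[nhds ξ] fun _ => c := by
    have ho : IsOpen (Ω ∩ (fun η => 8 * π * kd ξ η ^ 2 * (H η + b)) ⁻¹' Iio 1) :=
      ((hcont b).mono subset_closure).isOpen_inter_preimage h.isOpen isOpen_Iio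
    filter_upwards [ho.mem_nhds ⟨h.mem, by simp [kd_self]⟩] with z hz
    by_cases hne : z = ξ
    · simp [hW, hne, h.mem]
    · simp only [hW, hz.1, hne, if_true, if_false]
      exact hFb _ ((lt_green_iff hne b).1 hz.2).le
  have hWG : ∀ η ∈ Ω \ {ξ}, W =ᶠ[nhds η] fun z => F (Γξ ξ z - H z) := by
    intro η hη
    filter_upwards [h.isOpen_diff.mem_nhds hη] with z hz
    have hne : z ≠ ξ := hz.2
    simp [hW, hz.1, hne]
  refine ⟨W, contDiff_iff_contDiffAt.2 fun η => ?_, hKcpt.of_isClosed_subset (isClosed_tsupport _)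
    hsupp, hsupp.trans hKΩ, hWξ, hWG⟩
  by_cases hηK : η ∈ K
  · by_cases hne : η = ξ
    · subst hne
      exact contDiffAt_const.congr_of_eventuallyEq hWξ
    · have hη : η ∈ Ω \ {ξ} := ⟨hKΩ hηK, hne⟩
      refine ContDiffAt.congr_of_eventuallyEq ?_ (hWG η hη)
      exact hF.contDiffAt.comp η
        ((h.contDiffOn_green.contDiffAt (h.isOpen_diff.mem_nhds hη)).of_le one_le_two)
  · refine contDiffAt_const (c := (0 : ℝ)) |>.congr_of_eventuallyEq ?_
    filter_upwards [hKc.isOpen_compl.mem_nhds hηK] with z hz using hWK z hz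

lemma ae_mem_diff (h : IsRegularPart Ω ξ H) : ∀ᵐ η ∂volume.restrict Ω, η ∈ Ω \ {ξ} := by
  have : ∀ᵐ η : H1, η ≠ ξ := by simp [ae_iff]
  filter_upwards [ae_restrict_mem h.isOpen.measurableSet, ae_restrict_of_ae this] with η h1 h2
    using ⟨h1, h2⟩

lemma setIntegral_eq_integral_hdot (h : IsRegularPart Ω ξ H) {f : ℝ → ℝ} (hf : Continuous f)
    {a b : ℝ} (ha : 0 < a) (hfa : ∀ s ≤ a, f s = 0) (hfb : ∀ s, b ≤ s → f s = 0) :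
    ∃ W : H1 → ℝ, ContDiff ℝ 1 W ∧ HasCompactSupport W ∧
      (W =ᶠ[nhds ξ] fun _ => ∫ s in (0 : ℝ)..b, f s) ∧
      IntegrableOn (fun η => f (Γξ ξ η - H η) * hdot (fun z => Γξ ξ z - H z)
        (fun z => Γξ ξ z - H z) η) Ω ∧
      ∫ η in Ω, f (Γξ ξ η - H η) * hdot (fun z => Γξ ξ z - H z) (fun z => Γξ ξ z - H z) η =
        ∫ η, hdot W (Γξ ξ) η := by
  set F : ℝ → ℝ := fun s => ∫ x in (0 : ℝ)..s, f x with hFdef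
  have hFd (s : ℝ) : HasDerivAt F (f s) s := hf.integral_hasStrictDerivAt 0 s |>.hasDerivAt
  have hF : ContDiff ℝ 1 F := by
    refine contDiff_one_iff_deriv.2 ⟨fun s => (hFd s).differentiableAt, ?_⟩
    rwa [funext fun s => (hFd s).deriv]
  have hFa : ∀ s ≤ a, F s = 0 := by
    intro s hs
    refine intervalIntegral.integral_zero_ae (ae_of_all _ fun x hx => hfa x ?_)
    rcases uIoc_subset_uIcc hx with ⟨-, h2⟩
    exact h2.trans (sup_le ha.le hs)
  have hFb : ∀ s, b ≤ s → F s = F b := by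
    intro s hs
    have h1 := intervalIntegral.integral_add_adjacent_intervals (hf.intervalIntegrable 0 b)
      (hf.intervalIntegrable (μ := volume) b s)
    have h2 : ∫ x in b..s, f x = 0 := by
      refine intervalIntegral.integral_zero_ae (ae_of_all _ fun x hx => hfb x ?_)
      rw [uIoc_of_le hs] at hx
      exact hx.1.le
    simp only [hFdef, ← h1, h2, add_zero]
  obtain ⟨W, hW, hWc, hWΩ, hWξ, hWG⟩ := h.exists_truncation hF ha hFa hFb
  have hiΓ := integrable_hdot_Γξ hW hWc hWξ
  obtain ⟨hiH, hzH⟩ := integral_hdot_eq_zero hW hWc h.isOpen h.contDiffOn h.kohn_eq_zero hWΩ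
  have hae : (fun η => f (Γξ ξ η - H η) * hdot (fun z => Γξ ξ z - H z)
      (fun z => Γξ ξ z - H z) η) =ᵐ[volume.restrict Ω] fun η => hdot W (Γξ ξ) η - hdot W H η := by
    filter_upwards [h.ae_mem_diff] with η hη
    have hGd : DifferentiableAt ℝ (fun z => Γξ ξ z - H z) η :=
      (h.contDiffOn_green.contDiffAt (h.isOpen_diff.mem_nhds hη)).differentiableAt two_ne_zero
    rw [← hdot_sub_right, ← hdot_comp _ hGd (hFd _)]
    · simp only [hdot, Xd_congr (hWG η hη), Yd_congr (hWG η hη)]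
    · exact ((contDiffOn_Γξ ξ (n := 1)).contDiffAt
        (isOpen_compl_singleton.mem_nhds hη.2)).differentiableAt one_ne_zero
    · exact (h.contDiffOn.contDiffAt (h.isOpen.mem_nhds hη.1)).differentiableAt two_ne_zero
  refine ⟨W, hW, hWc, hWξ, ((hiΓ.sub hiH).integrableOn).congr hae.symm, ?_⟩
  rw [integral_congr_ae hae, setIntegral_eq_integral_of_forall_compl_eq_zero,
    integral_sub hiΓ hiH, hzH, sub_zero]
  intro η hη
  have : fderiv ℝ W η = 0 := by
    rw [(notMem_tsupport_iff_eventuallyEq.1 fun h0 => hη (hWΩ h0)).fderiv_eq]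
    simp
  rw [hdot_eq_zero_of_fderiv_eq_zero _ this, hdot_eq_zero_of_fderiv_eq_zero _ this, sub_zero]

/-- The truncated Dirichlet integrals of two Green's functions with the same pole agree. -/
lemma setIntegral_eq {Ω' : Set H1} {H' : H1 → ℝ} (h : IsRegularPart Ω ξ H)
    (h' : IsRegularPart Ω' ξ H') {f : ℝ → ℝ} (hf : Continuous f)
    {a b : ℝ} (ha : 0 < a) (hfa : ∀ s ≤ a, f s = 0) (hfb : ∀ s, b ≤ s → f s = 0) :
    ∫ η in Ω, f (Γξ ξ η - H η) * hdot (fun z => Γξ ξ z - H z) (fun z => Γξ ξ z - H z) η =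
    ∫ η in Ω', f (Γξ ξ η - H' η) * hdot (fun z => Γξ ξ z - H' z) (fun z => Γξ ξ z - H' z) η := by
  obtain ⟨W, hW, hWc, hWξ, -, e⟩ := h.setIntegral_eq_integral_hdot hf ha hfa hfb
  obtain ⟨W', hW', hWc', hWξ', -, e'⟩ := h'.setIntegral_eq_integral_hdot hf ha hfa hfb
  rw [e, e', ← sub_eq_zero, ← integral_sub (integrable_hdot_Γξ hW hWc hWξ)
    (integrable_hdot_Γξ hW' hWc' hWξ')]
  have hV : tsupport (fun z => W z - W' z) ⊆ {ξ}ᶜ := by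
    rintro z hz rfl
    refine notMem_tsupport_iff_eventuallyEq.2 ?_ hz
    filter_upwards [hWξ, hWξ'] with w h1 h2
    simp [h1, h2]
  rw [← (integral_hdot_eq_zero (hW.sub hW') (hWc.sub hWc') isOpen_compl_singleton
    (contDiffOn_Γξ ξ) (fun η hη => kohn_Γξ hη) hV).2]
  refine integral_congr_ae (ae_of_all _ fun η => ?_)
  simp only [hdot_comm _ (Γξ ξ)]
  rw [hdot_sub_right (hW.differentiable one_ne_zero η) (hW'.differentiable one_ne_zero η)]

end IsRegularPart

/-! ### Passage to the limit -/

lemma ae_fderiv_eq_zero_of_eq_const {u : H1 → ℝ} {c : ℝ} {s : Set H1} (hs : MeasurableSet s)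
    (hu : ∀ η ∈ s, u η = c) : ∀ᵐ η ∂volume.restrict s, fderiv ℝ u η = 0 := by
  set D : Set H1 := {η | DifferentiableAt ℝ u η}
  have hD : MeasurableSet D := measurableSet_of_differentiableAt ℝ u
  set L : ℝ →L[ℝ] H1 := ContinuousLinearMap.inl ℝ ℝ (ℝ × ℝ)
  have happrox : ApproximatesLinearOn (fun η => L (u η)) (0 : H1 →L[ℝ] H1) (s ∩ D) 0 := by
    intro x hx y hy
    simp [hu x hx.1, hu y hy.1]
  have key := happrox.norm_fderiv_sub_le (volume : Measure H1) (hs.inter hD)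
    (fun η => L.comp (fderiv ℝ u η)) (fun η hη =>
      (L.hasFDerivAt.comp η (hη.2 : DifferentiableAt ℝ u η).hasFDerivAt).hasFDerivWithinAt)
  rw [ae_restrict_iff' (hs.inter hD)] at key
  rw [ae_restrict_iff' hs]
  filter_upwards [key] with η h1 h2
  by_cases h3 : DifferentiableAt ℝ u η
  · have h4 := h1 ⟨h2, h3⟩
    simp only [sub_zero, nonpos_iff_eq_zero, nnnorm_eq_zero] at h4
    refine ContinuousLinearMap.ext fun v => ?_
    have := congrArg Prod.fst (DFunLike.congr_fun h4 v)
    simpa [L] using this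
  · exact fderiv_zero_of_not_differentiableAt h3

/-- Cutoff functions exhausting `(0, ∞)`. -/
def logCutoff (n : ℕ) (s : ℝ) : ℝ := max 0 (min 1 (n + 1 - |Real.log s|))

lemma logCutoff_nonneg (n : ℕ) (s : ℝ) : 0 ≤ logCutoff n s := le_max_left _ _

lemma logCutoff_mono {m n : ℕ} (h : m ≤ n) (s : ℝ) : logCutoff m s ≤ logCutoff n s := by
  have : (m : ℝ) ≤ n := by exact_mod_cast h
  unfold logCutoff
  gcongr

lemma tendsto_logCutoff (s : ℝ) :
    Filter.Tendsto (fun n => logCutoff n s) Filter.atTop (nhds 1) := by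
  refine tendsto_const_nhds.congr' ?_
  filter_upwards [Filter.eventually_ge_atTop ⌈|Real.log s|⌉₊] with n hn
  have : |Real.log s| ≤ n := (Nat.le_ceil _).trans (by exact_mod_cast hn)
  rw [logCutoff, min_eq_left (by linarith), max_eq_right zero_le_one]

lemma logCutoff_eq_zero {n : ℕ} {s : ℝ} (h : n + 1 ≤ |Real.log s|) : logCutoff n s = 0 :=
  max_eq_left (min_le_iff.2 (Or.inr (by linarith)))

/-- The function `ψ` on `(0, ∞)`, extended by zero and cut off near `0` and `∞`. -/
def truncPos (ψ : ℝ → ℝ) (n : ℕ) (s : ℝ) : ℝ := if 0 < s then ψ s * logCutoff n s else 0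

lemma truncPos_of_le {ψ : ℝ → ℝ} {n : ℕ} {s : ℝ} (h : s ≤ Real.exp (-(n + 1))) :
    truncPos ψ n s = 0 := by
  unfold truncPos
  split_ifs with hs
  · have := (Real.log_le_iff_le_exp hs).2 h
    rw [logCutoff_eq_zero (by linarith [neg_le_abs (Real.log s)]), mul_zero]
  · rfl

lemma truncPos_of_ge {ψ : ℝ → ℝ} {n : ℕ} {s : ℝ} (h : Real.exp (n + 1) ≤ s) :
    truncPos ψ n s = 0 := by
  have hs : 0 < s := (Real.exp_pos _).trans_le h
  have := (Real.le_log_iff_exp_le hs).2 h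
  rw [truncPos, if_pos hs, logCutoff_eq_zero (this.trans (le_abs_self _)), mul_zero]

lemma continuous_truncPos {ψ : ℝ → ℝ} (hψ : ContinuousOn ψ (Ioi 0)) (n : ℕ) :
    Continuous (truncPos ψ n) := by
  refine continuous_iff_continuousAt.2 fun s => ?_
  rcases lt_or_ge 0 s with hs | hs
  · have h1 : ContinuousAt (fun s => ψ s * logCutoff n s) s := by
      refine (hψ.continuousAt (Ioi_mem_nhds hs)).mul ?_
      unfold logCutoff
      have := Real.continuousAt_log hs.ne'
      exact continuousAt_const.max (continuousAt_const.min (continuousAt_const.sub this.abs))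
    refine h1.congr ?_
    filter_upwards [Ioi_mem_nhds hs] with x hx
    have hx' : 0 < x := hx
    simp [truncPos, hx']
  · refine (continuousAt_const (y := (0 : ℝ))).congr ?_
    filter_upwards [Iio_mem_nhds (hs.trans_lt (Real.exp_pos (-(n + 1 : ℝ))))] with x hx
    exact (truncPos_of_le (le_of_lt hx)).symm

lemma truncPos_nonneg {ψ : ℝ → ℝ} (hψ : ∀ s, 0 ≤ ψ s) (n : ℕ) (s : ℝ) : 0 ≤ truncPos ψ n s := by
  unfold truncPos
  split_ifs
  · exact mul_nonneg (hψ s) (logCutoff_nonneg n s)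
  · rfl

lemma truncPos_mono {ψ : ℝ → ℝ} (hψ : ∀ s, 0 ≤ ψ s) (s : ℝ) :
    Monotone fun n => truncPos ψ n s := by
  intro m n hmn
  simp only [truncPos]
  split_ifs
  · exact mul_le_mul_of_nonneg_left (logCutoff_mono hmn s) (hψ s)
  · rfl

lemma tendsto_truncPos (ψ : ℝ → ℝ) (s : ℝ) :
    Filter.Tendsto (fun n => truncPos ψ n s) Filter.atTop (nhds (if 0 < s then ψ s else 0)) := by
  unfold truncPos
  split_ifs
  · simpa using (tendsto_logCutoff s).const_mul (ψ s)
  · exact tendsto_const_nhds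

namespace IsRegularPart

variable {Ω : Set H1} {ξ : H1} {H : H1 → ℝ} {φ : ℝ → ℝ}

lemma ae_hdot_comp_eq (h : IsRegularPart Ω ξ H) (hφ : DifferentiableOn ℝ φ (Ioi 0)) :
    ∀ᵐ η ∂volume.restrict Ω,
      hdot (fun z => φ (Γξ ξ z - H z)) (fun z => φ (Γξ ξ z - H z)) η =
        (if 0 < Γξ ξ η - H η then deriv φ (Γξ ξ η - H η) ^ 2 else 0) *
          hdot (fun z => Γξ ξ z - H z) (fun z => Γξ ξ z - H z) η := by
  set Z : Set H1 := (Ω \ {ξ}) ∩ (fun z => Γξ ξ z - H z) ⁻¹' {0} with hZdef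
  have hZ : MeasurableSet Z := by
    have ho : IsOpen ((Ω \ {ξ}) ∩ (fun z => Γξ ξ z - H z) ⁻¹' {0}ᶜ) :=
      h.contDiffOn_green.continuousOn.isOpen_inter_preimage h.isOpen_diff isOpen_compl_singleton
    have : Z = (Ω \ {ξ}) \ ((Ω \ {ξ}) ∩ (fun z => Γξ ξ z - H z) ⁻¹' {0}ᶜ) := by
      ext z
      simp only [hZdef, mem_inter_iff, mem_sdiff, mem_preimage, mem_compl_iff]
      tauto
    rw [this]
    exact h.isOpen_diff.measurableSet.diff ho.measurableSet
  have hae := ae_fderiv_eq_zero_of_eq_const (u := fun z => φ (Γξ ξ z - H z)) (c := φ 0) hZ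
    (fun z hz => congrArg φ hz.2)
  rw [ae_restrict_iff' hZ] at hae
  filter_upwards [h.ae_mem_diff, ae_restrict_of_ae hae] with η hη h0
  rcases (sub_nonneg.2 (h.le_Γξ hη.1 hη.2)).lt_or_eq with hpos | hzero
  · have hGd : DifferentiableAt ℝ (fun z => Γξ ξ z - H z) η :=
      (h.contDiffOn_green.contDiffAt (h.isOpen_diff.mem_nhds hη)).differentiableAt two_ne_zero
    have hd := (hφ.differentiableAt (Ioi_mem_nhds hpos)).hasDerivAt
    rw [if_pos hpos, hdot_comp _ hGd hd, hdot_comm, hdot_comp _ hGd hd]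
    ring
  · rw [if_neg hzero.not_lt, zero_mul]
    exact hdot_eq_zero_of_fderiv_eq_zero _ (h0 ⟨hη, hzero.symm⟩)

lemma tendsto_setIntegral_truncPos (h : IsRegularPart Ω ξ H) (hφ : ContDiffOn ℝ 1 φ (Ioi 0)) :
    Filter.Tendsto (fun n => ENNReal.ofReal (∫ η in Ω,
        truncPos (fun s => deriv φ s ^ 2) n (Γξ ξ η - H η) *
          hdot (fun z => Γξ ξ z - H z) (fun z => Γξ ξ z - H z) η)) Filter.atTop
      (nhds (∫⁻ η in Ω, ENNReal.ofReal
        (hdot (fun z => φ (Γξ ξ z - H z)) (fun z => φ (Γξ ξ z - H z)) η))) := by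
  have hψ : ContinuousOn (fun s => deriv φ s ^ 2) (Ioi 0) :=
    (hφ.continuousOn_deriv_of_isOpen isOpen_Ioi le_rfl).pow 2
  have hint (n : ℕ) := (h.setIntegral_eq_integral_hdot (continuous_truncPos hψ n)
    (Real.exp_pos (-(n + 1))) (fun s => truncPos_of_le)
    (fun s => truncPos_of_ge)).choose_spec.2.2.2.1
  have hnn (n : ℕ) (s : ℝ) := truncPos_nonneg (ψ := fun s => deriv φ s ^ 2)
    (fun s => sq_nonneg _) n s
  simp_rw [fun n => ofReal_integral_eq_lintegral_ofReal (hint n)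
    (ae_of_all _ fun η => mul_nonneg (hnn n _) (hdot_self_nonneg _ η))]
  refine lintegral_tendsto_of_tendsto_of_monotone
    (fun n => (hint n).aestronglyMeasurable.aemeasurable.ennreal_ofReal) ?_ ?_
  · refine ae_of_all _ fun η m n hmn => ENNReal.ofReal_le_ofReal ?_
    exact mul_le_mul_of_nonneg_right (truncPos_mono (fun s => sq_nonneg _) _ hmn)
      (hdot_self_nonneg _ η)
  · filter_upwards [h.ae_hdot_comp_eq (hφ.differentiableOn one_ne_zero)] with η hη
    rw [hη]
    exact (ENNReal.continuous_ofReal.tendsto _).comp ((tendsto_truncPos _ _).mul_const _)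

/-- Harmonic transplantation between two domains with the same pole preserves the horizontal
Dirichlet integral. -/
theorem setIntegral_hdot_comp_eq {Ω' : Set H1} {H' : H1 → ℝ} (h : IsRegularPart Ω ξ H)
    (h' : IsRegularPart Ω' ξ H') (hφ : ContDiffOn ℝ 1 φ (Ioi 0)) :
    ∫ η in Ω, hdot (fun z => φ (Γξ ξ z - H z)) (fun z => φ (Γξ ξ z - H z)) η =
      ∫ η in Ω', hdot (fun z => φ (Γξ ξ z - H' z)) (fun z => φ (Γξ ξ z - H' z)) η := by
  have hψ : ContinuousOn (fun s => deriv φ s ^ 2) (Ioi 0) :=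
    (hφ.continuousOn_deriv_of_isOpen isOpen_Ioi le_rfl).pow 2
  have hlim := h.tendsto_setIntegral_truncPos hφ
  simp_rw [fun n => h.setIntegral_eq h' (continuous_truncPos hψ n) (Real.exp_pos (-(n + 1)))
    (fun s => truncPos_of_le) (fun s => truncPos_of_ge)] at hlim
  rw [integral_eq_lintegral_of_nonneg_ae (ae_of_all _ (hdot_self_nonneg _))
      (measurable_hdot _ _).aestronglyMeasurable,
    integral_eq_lintegral_of_nonneg_ae (ae_of_all _ (hdot_self_nonneg _))
      (measurable_hdot _ _).aestronglyMeasurable,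
    tendsto_nhds_unique hlim (h'.tendsto_setIntegral_truncPos hφ)]

end IsRegularPart

/-! ### Left translations and Koranyi balls -/

lemma hmul_hinv_cancel_left (ξ η : H1) : hmul ξ (hmul (hinv ξ) η) = η := by
  ext <;> simp [hmul, hinv]; ring

lemma hmul_hinv_cancel_left' (ξ η : H1) : hmul (hinv ξ) (hmul ξ η) = η := by
  ext <;> simp [hmul, hinv]; ring

lemma contDiff_hmul (ξ : H1) {n : WithTop ℕ∞} : ContDiff ℝ n (hmul ξ) := by
  unfold hmul; fun_prop

lemma measurePreserving_hmul (ξ : H1) : MeasurePreserving (hmul ξ) := by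
  have h2 (x : ℝ) : MeasurePreserving
      (fun p : ℝ × ℝ => (ξ.2.1 + p.1, ξ.2.2 + p.2 + 2 * (x * ξ.2.1 - ξ.1 * p.1))) := by
    refine (measurePreserving_add_left (volume : Measure ℝ) ξ.2.1).skew_product
      (g := fun y t => ξ.2.2 + t + 2 * (x * ξ.2.1 - ξ.1 * y)) (by fun_prop)
      (ae_of_all _ fun y => ?_)
    exact ((measurePreserving_add_right volume (2 * (x * ξ.2.1 - ξ.1 * y))).comp
      (measurePreserving_add_left (volume : Measure ℝ) ξ.2.2)).map_eq
  exact (measurePreserving_add_left (volume : Measure ℝ) ξ.1).skew_product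
    (g := fun x (p : ℝ × ℝ) => (ξ.2.1 + p.1, ξ.2.2 + p.2 + 2 * (x * ξ.2.1 - ξ.1 * p.1)))
    (by fun_prop) (ae_of_all _ fun x => (h2 x).map_eq)

lemma measurableEmbedding_hmul_hinv (ξ : H1) : MeasurableEmbedding (hmul (hinv ξ)) :=
  (contDiff_hmul (n := 0) _).continuous.measurableEmbedding
    (Function.LeftInverse.injective (hmul_hinv_cancel_left ξ))

lemma hmul_lineX (ξ η : H1) (s : ℝ) : hmul ξ (lineX η s) = lineX (hmul ξ η) s := by
  ext <;> simp [hmul, lineX] <;> ring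

lemma hmul_lineY (ξ η : H1) (s : ℝ) : hmul ξ (lineY η s) = lineY (hmul ξ η) s := by
  ext <;> simp [hmul, lineY] <;> ring

/-- The horizontal gradient is left invariant. -/
lemma hdot_comp_hmul (u : H1 → ℝ) (ξ η : H1) :
    hdot (fun z => u (hmul (hinv ξ) z)) (fun z => u (hmul (hinv ξ) z)) η =
      hdot u u (hmul (hinv ξ) η) := by
  have hL := (contDiff_hmul (n := 1) (hinv ξ)).differentiable one_ne_zero
  by_cases hu : DifferentiableAt ℝ u (hmul (hinv ξ) η)
  · have huL : DifferentiableAt ℝ (fun z => u (hmul (hinv ξ) z)) η := hu.comp η (hL η)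
    have hX := hasDerivAt_comp_lineX (s := 0) (by rwa [lineX_zero] : DifferentiableAt ℝ u _)
    have hY := hasDerivAt_comp_lineY (s := 0) (by rwa [lineY_zero] : DifferentiableAt ℝ u _)
    rw [lineX_zero] at hX
    rw [lineY_zero] at hY
    simp_rw [← hmul_lineX] at hX
    simp_rw [← hmul_lineY] at hY
    simp only [hdot, Xd_eq_of_hasDerivAt huL hX, Yd_eq_of_hasDerivAt huL hY]
  · have huL : ¬ DifferentiableAt ℝ (fun z => u (hmul (hinv ξ) z)) η := by
      intro h0
      refine hu ?_
      have h1 : DifferentiableAt ℝ (fun z => u (hmul (hinv ξ) z))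
          (hmul ξ (hmul (hinv ξ) η)) := by rwa [hmul_hinv_cancel_left]
      have := h1.comp (hmul (hinv ξ) η) ((contDiff_hmul (n := 1) ξ).differentiable one_ne_zero _)
      simpa only [Function.comp_def, hmul_hinv_cancel_left'] using this
    rw [hdot_eq_zero_of_fderiv_eq_zero _ (fderiv_zero_of_not_differentiableAt huL),
      hdot_eq_zero_of_fderiv_eq_zero _ (fderiv_zero_of_not_differentiableAt hu)]

lemma kd_nonneg (ξ η : H1) : 0 ≤ kd ξ η := by
  rw [kd_eq]; exact Real.rpow_nonneg (kquart_nonneg ξ η) _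

lemma kd_zero_hmul_hinv (ξ η : H1) : kd 0 (hmul (hinv ξ) η) = kd ξ η := by
  have : hmul (hinv 0) (hmul (hinv ξ) η) = hmul (hinv ξ) η := by
    ext <;> simp [hmul, hinv]
  rw [kd, this, kd]

lemma preimage_kball (ξ : H1) (r : ℝ) : hmul (hinv ξ) ⁻¹' kball 0 r = kball ξ r := by
  ext η
  simp only [kball, mem_preimage, mem_ofPred_eq, kd_zero_hmul_hinv]

lemma kball_eq {ξ : H1} {r : ℝ} (hr : 0 < r) : kball ξ r = {η | kd ξ η ^ 2 < r ^ 2} := by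
  ext η
  simp only [kball, mem_ofPred_eq, sq_lt_sq₀ (kd_nonneg ξ η) hr.le]

lemma isBounded_kball_zero {r : ℝ} (hr : 0 < r) : Bornology.IsBounded (kball 0 r) := by
  refine (Metric.isBounded_closedBall (x := (0 : H1)) (r := max r (r ^ 2))).subset fun η hη => ?_
  rw [kball_eq hr, mem_ofPred_eq, kd_sq, Real.sqrt_lt' (by positivity)] at hη
  simp only [kquart, Prod.fst_zero, Prod.snd_zero, sub_zero, zero_mul, mul_zero, add_zero] at hη
  have hxy : η.1 ^ 2 + η.2.1 ^ 2 ≤ r ^ 2 :=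
    abs_le_of_sq_le_sq' (by nlinarith [sq_nonneg η.2.2]) (by positivity) |>.2
  have hx : |η.1| ≤ r := abs_le_of_sq_le_sq (by nlinarith [sq_nonneg η.2.1]) hr.le
  have hy : |η.2.1| ≤ r := abs_le_of_sq_le_sq (by nlinarith [sq_nonneg η.1]) hr.le
  have ht : |η.2.2| ≤ r ^ 2 :=
    abs_le_of_sq_le_sq (by nlinarith [sq_nonneg (η.1 ^ 2 + η.2.1 ^ 2)]) (by positivity)
  rw [mem_closedBall_zero_iff, Prod.norm_def, Prod.norm_def]
  simp only [Real.norm_eq_abs, sup_le_iff]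
  exact ⟨hx.trans (le_max_left _ _), hy.trans (le_max_left _ _), ht.trans (le_max_right _ _)⟩

/-- The regular part of the Green's function of a Koranyi ball at its center is constant. -/
lemma isRegularPart_kball (ξ : H1) {r : ℝ} (hr : 0 < r) :
    IsRegularPart (kball ξ r) ξ fun _ => 1 / (8 * π * r ^ 2) where
  isOpen := by
    rw [kball_eq hr]
    exact isOpen_lt (continuous_kd_sq ξ) continuous_const
  isBounded := by
    refine ((isBounded_kball_zero hr).isCompact_closure.image
      (contDiff_hmul (n := 0) ξ).continuous).isBounded.subset fun η hη => ?_
    rw [← preimage_kball] at hη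
    exact ⟨_, subset_closure hη, hmul_hinv_cancel_left ξ η⟩
  mem := by
    change kd ξ ξ < r
    rwa [kd_self]
  continuousOn := continuousOn_const
  contDiffOn := contDiffOn_const
  kohn_eq_zero η _ := by
    have hX : Xd (fun _ => 1 / (8 * π * r ^ 2)) = fun _ => 0 := by ext; simp [Xd]
    have hY : Yd (fun _ => 1 / (8 * π * r ^ 2)) = fun _ => 0 := by ext; simp [Yd]
    rw [kohn, hX, hY]
    simp [Xd, Yd]
  eq_Γξ η hη := by
    rw [kball_eq hr] at hη
    have : kd ξ η ^ 2 = r ^ 2 :=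
      frontier_lt_subset_eq (continuous_kd_sq ξ) continuous_const hη
    rw [Γξ, this]

/-- The harmonic transplantation preserves the horizontal Dirichlet
integral: ∫_Ω |∇_ℍ U|² = ∫_{B(0,r)} |∇_ℍ u|² with u = φ∘g, U = φ∘G_ξ,
g the Green's function of B(0,r) at 0 and r = r_Ω(ξ). -/
theorem transplantation_dirichlet (Ω : Set H1) (hΩo : IsOpen Ω)
    (hΩb : Bornology.IsBounded Ω) (hsm : smoothBdry Ω)
    (hu1 : uebp Ω) (hu2 : uebp (Set.univ \ closure Ω))
    (ξ : H1) (hξ : ξ ∈ Ω) (H : H1 → ℝ)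
    (hHc : ContinuousOn H (closure Ω)) (hHd : ContDiffOn ℝ 2 H Ω)
    (hHh : ∀ η ∈ Ω, kohn H η = 0)
    (hHb : ∀ η ∈ frontier Ω, H η = Γξ ξ η)
    (hHξ : 0 < H ξ)
    (φ : ℝ → ℝ) (hφ : ContDiffOn ℝ 1 φ (Ioi 0)) (hφ0 : ∀ s ∈ Ioi (0 : ℝ), 0 ≤ φ s) :
    let r : ℝ := 1 / Real.sqrt (8 * π * H ξ)
    let g : H1 → ℝ := fun η => 1 / (8 * π * ρH η ^ 2) - 1 / (8 * π * r ^ 2)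
    let u : H1 → ℝ := fun η => φ (g η)
    let U : H1 → ℝ := fun η => φ (Γξ ξ η - H η)
    ∫ η in Ω, ((Xd U η) ^ 2 + (Yd U η) ^ 2) =
      ∫ η in kball 0 r, ((Xd u η) ^ 2 + (Yd u η) ^ 2) := by
  intro r g u U
  have hr : 0 < r := by positivity
  have hreg : IsRegularPart Ω ξ H := ⟨hΩo, hΩb, hξ, hHc, hHd, hHh, hHb⟩
  have hsq (w : H1 → ℝ) : (fun η => Xd w η ^ 2 + Yd w η ^ 2) = hdot w w := by
    ext η
    simp only [hdot, sq]
  rw [hsq U, hsq u, ← (measurePreserving_hmul (hinv ξ)).setIntegral_preimage_emb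
    (measurableEmbedding_hmul_hinv ξ) (hdot u u) (kball 0 r), preimage_kball]
  simp_rw [← hdot_comp_hmul]
  exact hreg.setIntegral_hdot_comp_eq (isRegularPart_kball ξ hr) hφ
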